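/- arXiv:0910.4511 — 3 statements merged into one kernel-verified Lean document; each statement's English description precedes it below -/
import Mathlib

section
/- Let b X_1 Y_1' X_2 Y_2' ⋯ X_n Y_n be an overlap prefix of some word over A, for a weakly C(4) finite monoid presentation ⟨A | R⟩. Then no relation word occurs as a factor of this prefix, except possibly as the suffix X_n Y_n in the case that the maximal piece suffix Z_n of the relation word X_n Y_n Z_n is the empty word. -/
open List

/-- A *relation word* is a word occurring as one side of some relation in `R`. -/
def RelWord {A : Type*} (R : Finset (List A × List A)) (w : List A) : Prop :=
  ∃ p ∈ R, w = p.1 ∨ w = p.2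

/-- One elementary rewriting step using a defining relation (in either direction). -/
def OneStep {A : Type*} (R : Finset (List A × List A)) (u v : List A) : Prop :=
  ∃ l r x y, ((x, y) ∈ R ∨ (y, x) ∈ R) ∧ u = l ++ x ++ r ∧ v = l ++ y ++ r

/-- `u ≡ v`: the congruence on the free monoid `A*` generated by the relations `R`. -/
def MEquiv {A : Type*} (R : Finset (List A × List A)) : List A → List A → Prop :=
  Relation.ReflTransGen (OneStep R)

/-- A *piece*: a word occurring as a factor of two distinct relation words, or in two
different (possibly overlapping) positions within one relation word.  The empty word
is a piece. -/
def Piece {A : Type*} (R : Finset (List A × List A)) (p : List A) : Prop :=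
  p = [] ∨ ∃ r₁ r₂ a₁ b₁ a₂ b₂, RelWord R r₁ ∧ RelWord R r₂ ∧
    r₁ = a₁ ++ p ++ b₁ ∧ r₂ = a₂ ++ p ++ b₂ ∧ (r₁ ≠ r₂ ∨ a₁ ≠ a₂)

/-- Weakly `C(n)`: no relation word is a product of strictly fewer than `n` pieces. -/
def WeaklyC {A : Type*} (R : Finset (List A × List A)) (n : ℕ) : Prop :=
  ∀ w, RelWord R w → ∀ L : List (List A), (∀ p ∈ L, Piece R p) → w = L.flatten →
    n ≤ L.length

/-- `X` is the maximal (longest) prefix of `r` which is a piece. -/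
def MaxPiecePrefix {A : Type*} (R : Finset (List A × List A)) (r X : List A) : Prop :=
  X <+: r ∧ Piece R X ∧ ∀ p, p <+: r → Piece R p → p.length ≤ X.length

/-- `Z` is the maximal (longest) suffix of `r` which is a piece. -/
def MaxPieceSuffix {A : Type*} (R : Finset (List A × List A)) (r Z : List A) : Prop :=
  Z <:+ r ∧ Piece R Z ∧ ∀ s, s <:+ r → Piece R s → s.length ≤ Z.length

/-- `X ++ Y ++ Z` is a relation word with maximal piece prefix `X`, middle word `Y`
and maximal piece suffix `Z`. -/
def RelDecomp {A : Type*} (R : Finset (List A × List A)) (X Y Z : List A) : Prop :=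
  RelWord R (X ++ Y ++ Z) ∧ MaxPiecePrefix R (X ++ Y ++ Z) X ∧
    MaxPieceSuffix R (X ++ Y ++ Z) Z

/-- `q` is a relation prefix of `u`: a prefix of the form `a ++ X ++ Y` where `X`, `Y`
are the maximal piece prefix and middle word of some relation word `X ++ Y ++ Z`. -/
def RelPrefix {A : Type*} (R : Finset (List A × List A)) (u q : List A) : Prop :=
  q <+: u ∧ ∃ a X Y Z, q = a ++ X ++ Y ∧ RelDecomp R X Y Z

/-- `a ++ X ++ Y` is an overlap prefix of `u`, with final maximal piece prefix `X` and
middle word `Y`, i.e. it admits a factorisation `b X₁ Y₁' ⋯ X_{n-1} Y_{n-1}' X_n Y_n`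
with `X = X_n`, `Y = Y_n`, no factor `X₀ Y₀` beginning strictly before the end of `b`,
each `X_i Y_i Z_i` a relation word factored into maximal piece prefix, middle word and
maximal piece suffix, and each `Y_i'` (`i < n`) a proper non-empty prefix of `Y_i`. -/
def OPrefix {A : Type*} (R : Finset (List A × List A)) (u a X Y : List A) : Prop :=
  (a ++ X ++ Y) <+: u ∧
  ∃ (b : List A) (n : ℕ) (Xs Ys Zs Ys' : ℕ → List A),
    1 ≤ n ∧ Xs (n - 1) = X ∧ Ys (n - 1) = Y ∧
    a = b ++ ((List.range (n - 1)).map fun i => Xs i ++ Ys' i).flatten ∧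
    (∀ i < n, RelDecomp R (Xs i) (Ys i) (Zs i)) ∧
    (∀ i < n - 1, Ys' i ≠ [] ∧ Ys' i <+: Ys i ∧ Ys' i ≠ Ys i) ∧
    ¬ ∃ c d X₀ Y₀ Z₀, RelDecomp R X₀ Y₀ Z₀ ∧
        a ++ X ++ Y = c ++ X₀ ++ Y₀ ++ d ∧ c.length < b.length

/-- The relation prefix `a ++ X ++ Y` of `u` is *clean*: `u` has no prefix
`a ++ X ++ Y₀ ++ X₁ ++ Y₁` with `Y₀` a proper non-empty prefix of `Y` and `X₁`, `Y₁`
the maximal piece prefix and middle word of some relation word. -/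
def CleanAt {A : Type*} (R : Finset (List A × List A)) (u a X Y : List A) : Prop :=
  ¬ ∃ Y₀ X₁ Y₁ Z₁, RelDecomp R X₁ Y₁ Z₁ ∧ Y₀ ≠ [] ∧ Y₀ <+: Y ∧ Y₀ ≠ Y ∧
      (a ++ X ++ Y₀ ++ X₁ ++ Y₁) <+: u

/-- `a ++ X ++ Y` is a clean overlap prefix of `u`, where `X ++ Y ++ Z` is a relation
word with maximal piece prefix `X`, middle word `Y` and maximal piece suffix `Z`. -/
def CleanOverlapPrefix {A : Type*} (R : Finset (List A × List A))
    (u a X Y Z : List A) : Prop :=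
  RelDecomp R X Y Z ∧ OPrefix R u a X Y ∧ CleanAt R u a X Y

/-- `r'` is a complement of the relation word `r`: there is a chain of relation words
from `r` to `r'` each consecutive pair of which forms a relation (in some order). -/
def RelComplement {A : Type*} (R : Finset (List A × List A)) (r r' : List A) : Prop :=
  RelWord R r ∧ Relation.ReflTransGen (fun s t => (s, t) ∈ R ∨ (t, s) ∈ R) r r'

/-- `u` is `p`-active: `p ++ u` has a relation prefix `a ++ X ++ Y` with `|a| < |p|`. -/
def PActive {A : Type*} (R : Finset (List A × List A)) (p u : List A) : Prop :=
  ∃ a X Y Z, RelDecomp R X Y Z ∧ (a ++ X ++ Y) <+: (p ++ u) ∧ a.length < p.length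

/-- `p` is a possible prefix of `u`: `p ++ w ≡ u` for some word `w`. -/
def PossPrefix {A : Type*} (R : Finset (List A × List A)) (p u : List A) : Prop :=
  ∃ w, MEquiv R (p ++ w) u

theorem Piece.of_infix {A : Type*} {R : Finset (List A × List A)} {p q : List A}
    (hp : Piece R p) (hq : q <:+: p) : Piece R q := by
  obtain ⟨x, y, rfl⟩ := hq
  rcases hp with hp | ⟨r₁, r₂, a₁, b₁, a₂, b₂, h₁, h₂, e₁, e₂, hne⟩
  · left
    simp_all
  · refine Or.inr ⟨r₁, r₂, a₁ ++ x, y ++ b₁, a₂ ++ x, y ++ b₂, h₁, h₂, by simp [e₁], by simp [e₂], ?_⟩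
    simpa using hne

/-- A word which is not a piece occurs at most once among all relation words. -/
theorem eq_of_not_piece {A : Type*} {R : Finset (List A × List A)} {p a₁ b₁ a₂ b₂ : List A}
    (hp : ¬ Piece R p) (h₁ : RelWord R (a₁ ++ p ++ b₁)) (h₂ : RelWord R (a₂ ++ p ++ b₂)) :
    a₁ = a₂ ∧ b₁ = b₂ := by
  by_contra hne
  refine hp (Or.inr ⟨_, _, a₁, b₁, a₂, b₂, h₁, h₂, rfl, rfl, ?_⟩)
  by_contra h
  push Not at h
  obtain ⟨h, rfl⟩ := h
  simp_all

theorem WeaklyC.not_piece_append {A : Type*} {R : Finset (List A × List A)} {n : ℕ}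
    (hC : WeaklyC R n) (hn : 3 ≤ n) {p q : List A} (hr : RelWord R (p ++ q))
    (hp : Piece R p) : ¬ Piece R q := by
  intro hq
  have := hC _ hr [p, q] (by simp [hp, hq]) (by simp)
  simp at this
  omega

theorem WeaklyC.not_piece {A : Type*} {R : Finset (List A × List A)} {n : ℕ}
    (hC : WeaklyC R n) (hn : 3 ≤ n) {r : List A} (hr : RelWord R r) : ¬ Piece R r :=
  hC.not_piece_append hn (p := []) hr (Or.inl rfl)

theorem exists_maxPiecePrefix {A : Type*} (R : Finset (List A × List A)) (r : List A) :
    ∃ X, MaxPiecePrefix R r X := by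
  classical
  have h0 : Piece R (r.take 0) := Or.inl (by simp)
  refine ⟨r.take (Nat.findGreatest (fun k => Piece R (r.take k)) r.length), take_prefix _ _,
    Nat.findGreatest_spec (P := fun k => Piece R (r.take k)) (Nat.zero_le _) h0, ?_⟩
  intro p hp hpp
  have hle := Nat.le_findGreatest (P := fun k => Piece R (r.take k)) hp.length_le
    (by rwa [← prefix_iff_eq_take.1 hp])
  rw [length_take]
  exact le_min hle hp.length_le

theorem exists_maxPieceSuffix {A : Type*} (R : Finset (List A × List A)) (r : List A) :
    ∃ Z, MaxPieceSuffix R r Z := by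
  classical
  have h0 : Piece R (r.drop (r.length - 0)) := Or.inl (by simp)
  refine ⟨r.drop (r.length - Nat.findGreatest (fun k => Piece R (r.drop (r.length - k))) r.length),
    drop_suffix _ _,
    Nat.findGreatest_spec (P := fun k => Piece R (r.drop (r.length - k))) (Nat.zero_le _) h0, ?_⟩
  intro p hp hpp
  have hle := Nat.le_findGreatest (P := fun k => Piece R (r.drop (r.length - k))) hp.length_le
    (by rwa [← suffix_iff_eq_drop.1 hp])
  have := hp.length_le
  rw [length_drop]
  omega

/-- In a weakly `C(3)` presentation every relation word factors through its maximal piece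
prefix and its maximal piece suffix. -/
theorem WeaklyC.exists_relDecomp {A : Type*} {R : Finset (List A × List A)} {n : ℕ}
    (hC : WeaklyC R n) (hn : 3 ≤ n) {r : List A} (hr : RelWord R r) :
    ∃ X Y Z, r = X ++ Y ++ Z ∧ RelDecomp R X Y Z := by
  obtain ⟨X, hX⟩ := exists_maxPiecePrefix R r
  obtain ⟨Z, hZ⟩ := exists_maxPieceSuffix R r
  obtain ⟨V, rfl⟩ := hX.1
  have hV := hC.not_piece_append hn hr hX.2.1
  rcases suffix_or_suffix_of_suffix (suffix_append X V) hZ.1 with h | ⟨Y, rfl⟩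
  · exact absurd (hZ.2.1.of_infix h.isInfix) hV
  · exact ⟨X, Y, Z, by simp, by simpa [RelDecomp] using ⟨hr, hX, hZ⟩⟩

theorem RelDecomp.not_piece_prefix {A : Type*} {R : Finset (List A × List A)}
    {X Y Z Y' : List A} (h : RelDecomp R X Y Z) (hY : Y' <+: Y) (hne : Y' ≠ []) :
    ¬ Piece R (X ++ Y') := by
  intro hp
  obtain ⟨W, rfl⟩ := hY
  have := h.2.1.2.2 _ ⟨W ++ Z, by simp⟩ hp
  simp at this
  exact hne this

theorem RelDecomp.not_piece_suffix {A : Type*} {R : Finset (List A × List A)}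
    {X Y Z Y' : List A} (h : RelDecomp R X Y Z) (hY : Y' <:+ Y) (hne : Y' ≠ []) :
    ¬ Piece R (Y' ++ Z) := by
  intro hp
  obtain ⟨W, rfl⟩ := hY
  have := h.2.2.2.2 _ ⟨X ++ W, by simp⟩ hp
  simp at this
  exact hne this

/-- A relation word starting inside `B` cannot be a factor of `B ++ D ++ E`, where `B ++ C` is a relation word, `C` is not a piece, and `B` and `D` are
prefixes of relation words which are not pieces. -/
theorem WeaklyC.no_relWord_of_start_in_block {A : Type*} {R : Finset (List A × List A)} {n : ℕ}
    (hC : WeaklyC R n) (hn : 3 ≤ n) {p B C D E F s r t : List A}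
    (hBC : RelWord R (B ++ C)) (hB : ¬ Piece R B) (hCp : ¬ Piece R C)
    (hDF : RelWord R (D ++ F)) (hD : ¬ Piece R D) (hr : RelWord R r)
    (hs : B = s ++ p) (hp : p ≠ []) (hfac : p ++ (D ++ E) = r ++ t) : False := by
  rcases append_eq_append_iff.1 hfac with ⟨q, rfl, hq⟩ | ⟨m, rfl, -⟩
  · have hDq : D <+: q → False := by
      rintro ⟨q', rfl⟩
      have := (eq_of_not_piece (a₁ := []) (b₁ := F) (a₂ := p) (b₂ := q') hD (by simpa using hDF)
        (by simpa using hr)).1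
      exact hp this.symm
    rcases append_eq_append_iff.1 hq with ⟨d, rfl, -⟩ | ⟨d, rfl, -⟩
    · exact hDq (prefix_append _ _)
    · have hqp : Piece R q := by
        by_contra hqp
        exact hp (eq_of_not_piece (a₁ := p) (b₁ := []) (a₂ := []) (b₂ := d ++ F) hqp
          (by simpa using hr) (by simpa using hDF)).1
      have hpp : ¬ Piece R p := fun hpp => hC.not_piece_append hn hr hpp hqp
      subst hs
      have := (eq_of_not_piece (a₁ := s) (b₁ := C) (a₂ := []) (b₂ := q) hpp
        (by simpa using hBC) (by simpa using hr)).2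
      exact hCp (this ▸ hqp)
  · subst hs
    have := (eq_of_not_piece (a₁ := s) (b₁ := m ++ C) (a₂ := []) (b₂ := [])
      (hC.not_piece hn hr) (by simpa using hBC) (by simpa using hr)).2
    exact hCp (Or.inl (append_eq_nil_iff.1 this).2)

/-- Relation words in a concatenation of non-piece prefixes of relation words followed by a
maximal piece prefix and its middle word. -/
theorem WeaklyC.relWord_in_blocks {A : Type*} {R : Finset (List A × List A)} {n : ℕ}
    (hC : WeaklyC R n) (hn : 3 ≤ n) {P Z : List A} (hPZ : RelWord R (P ++ Z))
    (hP : ¬ Piece R P) {r t : List A} (hr : RelWord R r) (L : List (List A)) (s : List A)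
    (hL : ∀ B ∈ L, ¬ Piece R B ∧ ∃ C, RelWord R (B ++ C) ∧ ¬ Piece R C)
    (hfac : L.flatten ++ P = s ++ (r ++ t)) :
    Z = [] ∧ r = P ∧ t = [] := by
  induction L generalizing s with
  | nil =>
    simp only [flatten_nil, nil_append] at hfac
    subst hfac
    obtain ⟨rfl, h⟩ := eq_of_not_piece (a₁ := s) (b₁ := t ++ Z) (a₂ := []) (b₂ := [])
      (hC.not_piece hn hr) (by simpa using hPZ) (by simpa using hr)
    simp_all
  | cons B L ih =>
    obtain ⟨hB, C, hBC, hCp⟩ := hL B (by simp)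
    rw [flatten_cons, append_assoc] at hfac
    have hstart : ∃ D E F, L.flatten ++ P = D ++ E ∧ RelWord R (D ++ F) ∧ ¬ Piece R D := by
      cases L with
      | nil => exact ⟨P, [], Z, by simp, hPZ, hP⟩
      | cons D L =>
        obtain ⟨hD, F, hDF, -⟩ := hL D (by simp)
        exact ⟨D, L.flatten ++ P, F, by simp, hDF, hD⟩
    have hL' := fun B' (hB' : B' ∈ L) => hL B' (mem_cons_of_mem _ hB')
    rcases append_eq_append_iff.1 hfac with ⟨s', rfl, h⟩ | ⟨p, hs, h⟩
    · exact ih s' hL' h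
    · by_cases hp : p = []
      · subst hp
        exact ih [] hL' (by simpa using h.symm)
      · obtain ⟨D, E, F, hDE, hDF, hD⟩ := hstart
        rw [hDE] at h
        exact (hC.no_relWord_of_start_in_block hn hBC hB hCp hDF hD hr hs hp h.symm).elim

/-- Proposition 1: for a weakly `C(4)` finite monoid presentation, an
overlap prefix `a X₁ Y₁' ⋯ Xₙ Yₙ = a ++ X ++ Y` of a word `u` contains no relation word
as a factor, except possibly the suffix `Xₙ Yₙ = X ++ Y` in the case `Zₙ = Z = ε`. -/
theorem overlapPrefix_no_relWord_factor {A : Type*} [Fintype A] [DecidableEq A]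
    (R : Finset (List A × List A)) (hC : WeaklyC R 4)
    (u a X Y Z : List A) (hop : OPrefix R u a X Y) (hZ : RelDecomp R X Y Z)
    (s r t : List A) (hr : RelWord R r) (hfac : a ++ X ++ Y = s ++ r ++ t) :
    Z = [] ∧ r = X ++ Y ∧ t = [] := by
  obtain ⟨-, b, n, Xs, Ys, Zs, Ys', -, -, -, rfl, hdec, hYs', hno⟩ := hop
  have hYne : Y ≠ [] := by
    rintro rfl
    exact hC.not_piece_append (by norm_num) (by simpa using hZ.1) hZ.2.1.2.1 hZ.2.2.2.1
  obtain ⟨X₀, Y₀, Z₀, rfl, h₀⟩ := hC.exists_relDecomp (by norm_num) hr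
  have hbs : b.length ≤ s.length := by
    by_contra! hlt
    exact hno ⟨s, Z₀ ++ t, X₀, Y₀, Z₀, h₀, by rw [hfac]; simp, hlt⟩
  obtain ⟨s', rfl⟩ : b <+: s := by
    rw [append_assoc, append_assoc, append_assoc] at hfac
    exact prefix_of_prefix_length_le (hfac ▸ prefix_append b _) (prefix_append s _) hbs
  refine hC.relWord_in_blocks (by norm_num) hZ.1 (hZ.not_piece_prefix prefix_rfl hYne) hr
    ((List.range (n - 1)).map fun i => Xs i ++ Ys' i) s' ?_ (by simpa using hfac)
  intro B hB
  obtain ⟨i, hi, rfl⟩ := mem_map.1 hB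
  have hi := mem_range.1 hi
  obtain ⟨hne, hpre, hlt⟩ := hYs' i hi
  have hd := hdec i (by omega)
  refine ⟨hd.not_piece_prefix hpre hne, ?_⟩
  obtain ⟨W, hW⟩ := hpre
  refine ⟨W ++ Zs i, ?_, hd.not_piece_suffix ⟨_, hW⟩ ?_⟩
  · have := hd.1
    rw [← hW] at this
    simpa using this
  · rintro rfl
    exact hlt (by simpa using hW)
end

section
/- For a weakly C(4) finite monoid presentation ⟨A | R⟩ and any word u over A, every overlap prefix of u is a prefix of some clean overlap prefix of u. -/
open List

/-- In a weakly `C(4)` presentation, middle words are non-empty. -/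
theorem RelDecomp.middle_ne_nil {A : Type*} {R : Finset (List A × List A)}
    (hC : WeaklyC R 4) {X Y Z : List A} (h : RelDecomp R X Y Z) : Y ≠ [] := by
  rintro rfl
  have h4 : 4 ≤ [X, Z].length :=
    hC _ h.1 [X, Z] (by simp [h.2.1.2.1, h.2.2.2.1]) (by simp)
  simp at h4

/-- In a weakly `C(4)` presentation, a maximal piece prefix followed by its middle word
occurs in relation words only as a prefix. -/
theorem RelDecomp.not_proper_factor {A : Type*} {R : Finset (List A × List A)}
    (hC : WeaklyC R 4) {X Y Z w c d : List A} (h : RelDecomp R X Y Z) (hw : RelWord R w)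
    (hc : c ≠ []) : w ≠ c ++ (X ++ Y) ++ d := by
  intro heq
  have hpiece : Piece R (X ++ Y) :=
    Or.inr ⟨w, _, c, d, [], Z, hw, h.1, heq, by simp, Or.inr hc⟩
  have hlen := h.2.1.2.2 (X ++ Y) (prefix_append _ _) hpiece
  have := length_pos_iff.mpr (h.middle_ne_nil hC)
  simp only [length_append] at hlen
  omega

theorem OPrefix.exists_relDecomp {A : Type*} {R : Finset (List A × List A)}
    {u a X Y : List A} (h : OPrefix R u a X Y) : ∃ Z, RelDecomp R X Y Z := by
  obtain ⟨-, b, n, Xs, Ys, Zs, Ys', hn, rfl, rfl, -, hdec, -⟩ := h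
  exact ⟨_, hdec (n - 1) (by omega)⟩

/-- A relation prefix overlapping the middle word of another one ends strictly later. -/
theorem RelDecomp.length_lt_of_overlap {A : Type*} {R : Finset (List A × List A)}
    (hC : WeaklyC R 4) {u a X Y Z Y₀ X₁ Y₁ Z₁ : List A} (h : RelDecomp R X Y Z)
    (h₁ : RelDecomp R X₁ Y₁ Z₁) (hY₀ : Y₀ ≠ []) (hp : (a ++ X ++ Y) <+: u)
    (hp₁ : (a ++ X ++ Y₀ ++ X₁ ++ Y₁) <+: u) :
    (a ++ X ++ Y).length < (a ++ X ++ Y₀ ++ X₁ ++ Y₁).length := by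
  by_contra! hle
  obtain ⟨d, hd⟩ := prefix_of_prefix_length_le hp₁ hp hle
  have hY : Y = Y₀ ++ X₁ ++ Y₁ ++ d := by simpa using hd.symm
  refine h₁.not_proper_factor hC h.1 (c := X ++ Y₀) (d := d ++ Z) (by simp [hY₀]) ?_
  simp [hY]

/-- An overlap prefix extends by any relation prefix witnessing that it is not clean. -/
theorem OPrefix.extend {A : Type*} {R : Finset (List A × List A)} (hC : WeaklyC R 4)
    {u a X Y Y₀ X₁ Y₁ Z₁ : List A} (h : OPrefix R u a X Y) (h₁ : RelDecomp R X₁ Y₁ Z₁)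
    (hne : Y₀ ≠ []) (hpre : Y₀ <+: Y) (hprop : Y₀ ≠ Y)
    (hp₁ : (a ++ X ++ Y₀ ++ X₁ ++ Y₁) <+: u) : OPrefix R u (a ++ X ++ Y₀) X₁ Y₁ := by
  obtain ⟨Z, hZ⟩ := h.exists_relDecomp
  obtain ⟨hp, b, n, Xs, Ys, Zs, Ys', hn, hX, hY, ha, hdec, hY', hno⟩ := h
  obtain ⟨m, rfl⟩ : ∃ m, n = m + 1 := ⟨n - 1, by omega⟩
  simp only [Nat.add_sub_cancel] at hX hY ha hY'
  refine ⟨hp₁, b, m + 2, Function.update Xs (m + 1) X₁, Function.update Ys (m + 1) Y₁,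
    Function.update Zs (m + 1) Z₁, Function.update Ys' m Y₀, by omega, by simp, by simp,
    ?_, ?_, ?_, ?_⟩
  · have hmap : (range m).map (fun i => Function.update Xs (m + 1) X₁ i ++
        Function.update Ys' m Y₀ i) = (range m).map fun i => Xs i ++ Ys' i := by
      refine map_congr_left fun i hi => ?_
      have hi := mem_range.mp hi
      rw [Function.update_of_ne (by omega), Function.update_of_ne (by omega)]
    have hm : m + 2 - 1 = m + 1 := rfl
    rw [hm, range_succ, map_append, hmap, ha]
    simp [hX]
  · intro i hi
    rcases eq_or_ne i (m + 1) with rfl | hne'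
    · simpa using h₁
    · simpa [hne'] using hdec i (by omega)
  · intro i hi
    rw [Function.update_of_ne (by omega : i ≠ m + 1)]
    rcases eq_or_ne i m with rfl | hne'
    · simpa [hY] using ⟨hne, hpre, hprop⟩
    · simpa [hne'] using hY' i (by omega)
  · rintro ⟨c, d, X₀, Y₂, Z₀, h₀, heq, hcb⟩
    have hq : (c ++ X₀ ++ Y₂) <+: u := (prefix_append _ d).trans (heq ▸ hp₁)
    rcases le_or_gt (c ++ X₀ ++ Y₂).length (a ++ X ++ Y).length with hle | hlt
    · obtain ⟨e, he⟩ := prefix_of_prefix_length_le hq hp hle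
      exact hno ⟨c, e, X₀, Y₂, Z₀, h₀, he.symm, hcb⟩
    · obtain ⟨e, he⟩ := prefix_of_prefix_length_le hp hq hlt.le
      have hba : b.length ≤ a.length := by simp [ha]
      have hca : c <+: a := by
        refine prefix_of_prefix_length_le (l₃ := u) ?_ ?_ (by omega)
        · exact (prefix_append c (X₀ ++ Y₂)).trans (by simpa using hq)
        · exact (prefix_append a (X ++ Y)).trans (by simpa using hp)
      obtain ⟨f, rfl⟩ := hca
      have hf : f ≠ [] := by
        rintro rfl
        simp only [append_nil] at hba
        omega
      have hXY : f ++ (X ++ Y) ++ e = X₀ ++ Y₂ := by simpa using he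
      refine hZ.not_proper_factor hC h₀.1 (c := f) (d := e ++ Z₀) hf ?_
      rw [← hXY]
      simp

/-- Proposition 2: for a weakly `C(4)` finite monoid presentation,
every overlap prefix of a word `u` is a prefix of some clean overlap prefix of `u`. -/
theorem overlapPrefix_contained_in_cleanOverlapPrefix {A : Type*} [Fintype A]
    [DecidableEq A] (R : Finset (List A × List A)) (hC : WeaklyC R 4)
    (u a X Y : List A) (hop : OPrefix R u a X Y) :
    ∃ a' X' Y' Z', CleanOverlapPrefix R u a' X' Y' Z' ∧
      (a ++ X ++ Y) <+: (a' ++ X' ++ Y') := by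
  obtain ⟨Z, hZ⟩ := hop.exists_relDecomp
  by_cases hclean : CleanAt R u a X Y
  · exact ⟨a, X, Y, Z, ⟨hZ, hop, hclean⟩, prefix_rfl⟩
  · obtain ⟨Y₀, X₁, Y₁, Z₁, h₁, hne, hpre, hprop, hp₁⟩ := not_not.mp hclean
    have hlt := hZ.length_lt_of_overlap hC h₁ hne hop.1 hp₁
    obtain ⟨a', X', Y', Z', hc, hp'⟩ :=
      overlapPrefix_contained_in_cleanOverlapPrefix R hC u (a ++ X ++ Y₀) X₁ Y₁
        (hop.extend hC h₁ hne hpre hprop hp₁)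
    exact ⟨a', X', Y', Z', hc, (prefix_of_prefix_length_le hop.1 hp₁ hlt.le).trans hp'⟩
termination_by u.length - (a ++ X ++ Y).length
decreasing_by
  have := hp₁.length_le
  omega
end

section
/- For a weakly C(4) finite monoid presentation ⟨A | R⟩: suppose u = w·X·Y·Z·u′, where XYZ is a relation word with maximal piece prefix X, middle word Y and maximal piece suffix Z, and wXY is a clean overlap prefix of u. If X̄ȲZ̄ is a complement of XYZ (with maximal piece prefix X̄, middle word Ȳ, maximal piece suffix Z̄), then wX̄Ȳ is a clean overlap prefix of the word w·X̄·Ȳ·Z̄·u′. -/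
open List

/-- A prefix of a relation word that also occurs at a non-initial position of a relation word
is a piece, hence is no longer than the maximal piece prefix. -/
theorem RelDecomp.length_le_of_factor {A : Type*} {R : Finset (List A × List A)}
    {X Y Z p a b : List A} (h : RelDecomp R X Y Z) (hp : p <+: X ++ Y ++ Z)
    (hr : RelWord R (a ++ p ++ b)) (ha : a ≠ []) : p.length ≤ X.length := by
  obtain ⟨q, hq⟩ := hp
  exact h.2.1.2.2 p ⟨q, hq⟩ (Or.inr ⟨_, _, [], q, a, b, h.1, hr, by simp [hq], rfl,
    Or.inr ha.symm⟩)

theorem RelDecomp.not_piece_middle {A : Type*} {R : Finset (List A × List A)}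
    (hC : WeaklyC R 4) {X Y Z : List A} (h : RelDecomp R X Y Z) : ¬ Piece R Y := by
  intro hY
  have := hC _ h.1 [X, Y, Z] (by simp [h.2.1.2.1, h.2.2.2.1, hY]) (by simp)
  simp at this

theorem RelDecomp.middle_length_pos {A : Type*} {R : Finset (List A × List A)}
    (hC : WeaklyC R 4) {X Y Z : List A} (h : RelDecomp R X Y Z) : 0 < Y.length :=
  List.length_pos_of_ne_nil fun hY => h.not_piece_middle hC (Or.inl hY)

/-- A relation prefix that is followed by its own maximal piece suffix is clean. -/
theorem RelDecomp.cleanAt {A : Type*} {R : Finset (List A × List A)}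
    (hC : WeaklyC R 4) {X Y Z : List A} (h : RelDecomp R X Y Z) (w v : List A) :
    CleanAt R (w ++ X ++ Y ++ Z ++ v) w X Y := by
  rintro ⟨Y₀, X₁, Y₁, Z₁, h₁, hne, ⟨e, rfl⟩, hproper, f, hf⟩
  have he : e ≠ [] := by rintro rfl; simp at hproper
  have hf' : (X₁ ++ Y₁) ++ f = (e ++ Z) ++ v := by simpa using hf
  have hpos : X ++ Y₀ ≠ [] := by simp [hne]
  have hY₁ := h₁.middle_length_pos hC
  rcases List.append_eq_append_iff.1 hf' with ⟨m, hm, -⟩ | ⟨m, hm, -⟩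
  · have hr : RelWord R ((X ++ Y₀) ++ (X₁ ++ Y₁) ++ m) := by
      have h₂ := h.1
      rwa [show X ++ (Y₀ ++ e) ++ Z = (X ++ Y₀) ++ (e ++ Z) by simp, hm,
        ← List.append_assoc] at h₂
    have := h₁.length_le_of_factor ⟨Z₁, rfl⟩ hr hpos
    rw [List.length_append] at this
    omega
  · have hpiece : Piece R (e ++ Z) := Or.inr ⟨_, _, [], m ++ Z₁, X ++ Y₀, [], h₁.1, h.1,
      by simp [hm], by simp, Or.inr hpos.symm⟩
    have := h.2.2.2.2 (e ++ Z) ⟨X ++ Y₀, by simp⟩ hpiece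
    have := List.length_pos_of_ne_nil he
    simp only [List.length_append] at *
    omega

/-- If `X₀ ++ Y₀` begins inside `w` and ends inside `X ++ Y`, but beyond `w`, in the word
`w ++ X ++ Y`, then `X₀` and a proper non-empty prefix of `Y₀` lie inside `w`. -/
theorem RelDecomp.exists_overlap {A : Type*} {R : Finset (List A × List A)}
    (hC : WeaklyC R 4) {X Y Z X₀ Y₀ Z₀ s t d : List A} (h : RelDecomp R X Y Z)
    (h₀ : RelDecomp R X₀ Y₀ Z₀) (ht : t ≠ []) (hs : s ≠ [])
    (hts : X₀ ++ Y₀ = t ++ s) (hsd : X ++ Y = s ++ d) :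
    ∃ Y', t = X₀ ++ Y' ∧ Y' ≠ [] ∧ Y' <+: Y₀ ∧ Y' ≠ Y₀ := by
  have key : ∀ m, X₀ = t ++ m → s ≠ m ++ Y₀ := by
    rintro m hm rfl
    refine h₀.not_piece_middle hC (Or.inr ⟨_, _, X₀, Z₀, m, d ++ Z, h₀.1, h.1, rfl,
      by simp [hsd], Or.inr fun hX => ht ?_⟩)
    rw [hm] at hX
    simpa using hX
  rcases List.append_eq_append_iff.1 hts with ⟨m, hm, hY⟩ | ⟨m, hm, hsm⟩
  · refine ⟨m, hm, ?_, ⟨s, hY.symm⟩, ?_⟩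
    · rintro rfl
      exact key [] (by simpa using hm.symm) (by simpa using hY.symm)
    · rintro rfl
      simp [hs] at hY
  · exact (key m hm hsm).elim

/-- Replacing the final relation word `X ++ Y ++ Z` following an overlap prefix by any other
relation word gives an overlap prefix again. -/
theorem OPrefix.replace {A : Type*} {R : Finset (List A × List A)} (hC : WeaklyC R 4)
    {u w X Y X' Y' Z' v : List A} (hO : OPrefix R u w X Y) (hdec : RelDecomp R X' Y' Z') :
    OPrefix R (w ++ X' ++ Y' ++ v) w X' Y' := by
  obtain ⟨-, b, n, Xs, Ys, Zs, Ys', hn, -, -, hw, hD, hP, hno⟩ := hO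
  refine ⟨⟨v, rfl⟩, ?_⟩
  have hbw : b.length ≤ w.length := by simp [hw]
  -- A factor beginning inside `b` has to end beyond `w`.
  have hsplit : ∀ c d X₀ Y₀ Z₀, RelDecomp R X₀ Y₀ Z₀ → w ++ X' ++ Y' = c ++ X₀ ++ Y₀ ++ d →
      c.length < b.length →
      ∃ t s, w = c ++ t ∧ t ≠ [] ∧ s ≠ [] ∧ X₀ ++ Y₀ = t ++ s ∧ X' ++ Y' = s ++ d := by
    intro c d X₀ Y₀ Z₀ h₀ he hc
    have inside : ∀ m, w ≠ c ++ X₀ ++ Y₀ ++ m := fun m hm =>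
      hno ⟨c, m ++ X ++ Y, X₀, Y₀, Z₀, h₀, by simp [hm], hc⟩
    have he' : w ++ (X' ++ Y') = (c ++ (X₀ ++ Y₀)) ++ d := by simpa using he
    rcases List.append_eq_append_iff.1 he' with ⟨s, hs, hs'⟩ | ⟨m, hm, -⟩
    · rcases List.append_eq_append_iff.1 hs with ⟨t, ht, hts⟩ | ⟨t, ht, -⟩
      · refine ⟨t, s, ht, ?_, ?_, hts, hs'⟩
        · rintro rfl
          rw [List.append_nil] at ht
          subst ht
          omega
        · rintro rfl
          exact inside [] (by simpa using hs.symm)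
      · have := congrArg List.length ht
        rw [List.length_append] at this
        omega
    · exact (inside m (by simpa using hm)).elim
  by_cases hbad : ∃ k c d X₀ Y₀ Z₀, RelDecomp R X₀ Y₀ Z₀ ∧
      w ++ X' ++ Y' = c ++ X₀ ++ Y₀ ++ d ∧ c.length < b.length ∧ c.length = k
  · -- Take the first such factor: it overlaps `X'`, and starts a new factorisation.
    classical
    have hmin := fun k => Nat.find_min (m := k) hbad
    obtain ⟨c, d, X₀, Y₀, Z₀, h₀, he, hc, hk⟩ := Nat.find_spec hbad
    obtain ⟨t, s, hwt, ht, hs, hts, hsd⟩ := hsplit c d X₀ Y₀ Z₀ h₀ he hc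
    obtain ⟨Y₀', htY, hne, hpre, hproper⟩ := hdec.exists_overlap hC h₀ ht hs hts hsd
    refine ⟨c, 2, fun i => if i = 0 then X₀ else X', fun i => if i = 0 then Y₀ else Y',
      fun i => if i = 0 then Z₀ else Z', fun _ => Y₀', by simp, by simp, by simp,
      by simp [List.range_succ, hwt, htY], ?_, ?_, ?_⟩
    · intro i _
      by_cases hi : i = 0 <;> simp [hi, h₀, hdec]
    · intro i hi
      obtain rfl : i = 0 := by omega
      exact ⟨hne, by simpa using hpre, by simpa using hproper⟩
    · rintro ⟨c', d', X₁, Y₁, Z₁, h₁, he', hc'⟩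
      exact hmin c'.length (by omega) ⟨c', d', X₁, Y₁, Z₁, h₁, he', by omega, rfl⟩
  · refine ⟨b, n, Function.update Xs (n - 1) X', Function.update Ys (n - 1) Y',
      Function.update Zs (n - 1) Z', Ys', hn, by simp, by simp, ?_, ?_, ?_, ?_⟩
    · rw [hw]
      congr 2
      refine List.map_congr_left fun i hi => ?_
      rw [Function.update_of_ne (List.mem_range.1 hi).ne]
    · intro i hi
      by_cases h : i = n - 1
      · subst h; simpa using hdec
      · simpa [Function.update_of_ne h] using hD i hi
    · intro i hi
      simpa [Function.update_of_ne hi.ne] using hP i hi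
    · rintro ⟨c, d, X₀, Y₀, Z₀, h₀, he, hc⟩
      exact hbad ⟨_, c, d, X₀, Y₀, Z₀, h₀, he, hc, rfl⟩

/-- Lemma, "stays clean": for a weakly `C(4)` finite monoid
presentation, if `u = w ++ X ++ Y ++ Z ++ u'` with `w ++ X ++ Y` a clean overlap prefix
of `u` (where `X ++ Y ++ Z` is a relation word factored into maximal piece prefix,
middle word and maximal piece suffix), and `X' ++ Y' ++ Z'` is a complement of
`X ++ Y ++ Z` (similarly factored), then `w ++ X' ++ Y'` is a clean overlap prefix of
`w ++ X' ++ Y' ++ Z' ++ u'`. -/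
theorem cleanOverlapPrefix_of_complement {A : Type*} [Fintype A] [DecidableEq A]
    (R : Finset (List A × List A)) (hC : WeaklyC R 4)
    (u w X Y Z u' X' Y' Z' : List A)
    (hu : u = w ++ X ++ Y ++ Z ++ u')
    (hclean : CleanOverlapPrefix R u w X Y Z)
    (hcomp : RelComplement R (X ++ Y ++ Z) (X' ++ Y' ++ Z'))
    (hdec : RelDecomp R X' Y' Z') :
    CleanOverlapPrefix R (w ++ X' ++ Y' ++ Z' ++ u') w X' Y' Z' := by
  have hO := hclean.2.1.replace hC (v := Z' ++ u') hdec
  rw [← List.append_assoc] at hO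
  exact ⟨hdec, hO, hdec.cleanAt hC w u'⟩
end
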